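/- arXiv:2007.03493 — 2 statements merged into one kernel-verified Lean document; each statement's English description precedes it below -/
import Mathlib

section
/- Let d ≥ 2, ρ > 0, α > 0, δ > 0, 0 < ε_0 < 1 and 0 < ξ ≤ 1. Then there exists λ ∈ (0, ε_0), depending only on ε_0, ξ, δ (and ρ, α), such that the following holds: if B_s ⊆ ℝ^d is any closed ball of radius s > 0 and E ⊆ B_s is any Lebesgue-measurable set with 𝓛^d(E ∩ B)/𝓛^d(B) < ρ(1 + α) for every closed ball B ⊆ B_s of radius at least λs, then for all ε ∈ [ξε_0, ε_0], ∫_E ∫_E K_{εs}^{(d)}(x − y) dx dy < (A_{εs}^d)² (1 + ε)^d ((1 + α)² ρ² + δ) 𝓛^d(B_s). -/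
open MeasureTheory Filter
open scoped Classical

/-- The kernel `K_r^{(d)} : ℝ^d → [0,∞]`, equal to
`2r²π^{(d-1)/2}(r² - ‖v‖²/4)^{(d-3)/2} / (Γ((d-1)/2)‖v‖)` for `0 < ‖v‖ < 2r`, to `0` for
`‖v‖ > 2r`, and to `+∞` when `v = 0` or `‖v‖ = 2r`. -/
noncomputable def kernelK (d : ℕ) (r : ℝ) (v : EuclideanSpace ℝ (Fin d)) : ENNReal :=
  if v = 0 ∨ ‖v‖ = 2 * r then ⊤
  else if 2 * r < ‖v‖ then 0
  else ENNReal.ofReal (2 * r ^ 2 * Real.pi ^ (((d : ℝ) - 1) / 2) *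
    (r ^ 2 - ‖v‖ ^ 2 / 4) ^ (((d : ℝ) - 3) / 2) / (Real.Gamma (((d : ℝ) - 1) / 2) * ‖v‖))

/-- `A_r^d = d r^{d-1} π^{d/2} / Γ(d/2 + 1)`, the `(d-1)`-dimensional surface area of a ball
of radius `r` in `ℝ^d`. -/
noncomputable def surfArea (d : ℕ) (r : ℝ) : ℝ :=
  d * r ^ (d - 1) * Real.pi ^ ((d : ℝ) / 2) / Real.Gamma ((d : ℝ) / 2 + 1)

lemma integral_radial_beta (d : ℕ) (hd : 2 ≤ d) :
    ∫ y in Set.Ioi (0 : ℝ), y ^ (d - 1) * (if y < 2 then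
      (1 - y ^ 2 / 4) ^ (((d : ℝ) - 3) / 2) / y else 0) =
    2⁻¹ * 4 ^ (((d : ℝ) - 1) / 2) *
      ProbabilityTheory.beta (((d : ℝ) - 1) / 2) (((d : ℝ) - 1) / 2) := by
  set a : ℝ := ((d : ℝ) - 1) / 2 with ha
  have hd' : (2 : ℝ) ≤ d := by exact_mod_cast hd
  have ha0 : 0 < a := by rw [ha]; linarith
  have hB := ProbabilityTheory.beta_pos ha0 ha0
  have key : ∀ y ∈ Set.Ioi (0 : ℝ), y ^ (d - 1) * (if y < 2 then
      (1 - y ^ 2 / 4) ^ (((d : ℝ) - 3) / 2) / y else 0) =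
      (2 * y ^ ((2 : ℝ) - 1)) • (2⁻¹ * 4 ^ (a - 1) * ProbabilityTheory.beta a a *
        ProbabilityTheory.betaPDFReal a a (4⁻¹ * y ^ (2 : ℝ))) := by
    intro y hy
    have hy : 0 < y := hy
    have h21 : (2 : ℝ) - 1 = 1 := by norm_num
    rw [ProbabilityTheory.betaPDFReal, h21, Real.rpow_one, Real.rpow_two]
    by_cases h2 : y < 2
    · have h1 : 0 < 4⁻¹ * y ^ 2 ∧ 4⁻¹ * y ^ 2 < 1 := ⟨by positivity, by nlinarith⟩
      have h4 : (4⁻¹ * y ^ 2) ^ (a - 1) = (4 ^ (a - 1))⁻¹ * y ^ ((d : ℝ) - 3) := by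
        rw [Real.mul_rpow (by norm_num) (by positivity), Real.inv_rpow (by norm_num),
          ← Real.rpow_two, ← Real.rpow_mul hy.le]
        congr 2
        rw [ha]; ring
      have h5 : y ^ (d - 1) = y * y * y ^ ((d : ℝ) - 3) := by
        rw [← Real.rpow_natCast, Nat.cast_sub (by lia)]
        have : ((d : ℝ) - ((1 : ℕ) : ℝ)) = 1 + 1 + ((d : ℝ) - 3) := by push_cast; ring
        rw [this, Real.rpow_add hy, Real.rpow_add hy, Real.rpow_one]
      have h6 : ((d : ℝ) - 3) / 2 = a - 1 := by rw [ha]; ring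
      have h7 : (0 : ℝ) < 4 ^ (a - 1) := by positivity
      rw [if_pos h2, if_pos h1, h4, h5, h6, smul_eq_mul]
      have h8 : 1 - y ^ 2 / 4 = 1 - 4⁻¹ * y ^ 2 := by ring
      rw [h8]
      field_simp
    · have h1 : ¬ (0 < 4⁻¹ * y ^ 2 ∧ 4⁻¹ * y ^ 2 < 1) := by
        rintro ⟨-, h⟩
        nlinarith
      rw [if_neg h2, if_neg h1]
      simp
  rw [setIntegral_congr_fun measurableSet_Ioi key,
    integral_comp_rpow_Ioi_of_pos (g := fun t => 2⁻¹ * 4 ^ (a - 1) * ProbabilityTheory.beta a a *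
        ProbabilityTheory.betaPDFReal a a (4⁻¹ * t)) (by norm_num : (0 : ℝ) < 2),
    integral_const_mul, integral_comp_mul_left_Ioi _ _ (by norm_num : (0 : ℝ) < 4⁻¹)]
  have h1 : ∫ x in Set.Ioi ((4 : ℝ)⁻¹ * 0), ProbabilityTheory.betaPDFReal a a x = 1 := by
    rw [mul_zero, setIntegral_eq_integral_of_forall_compl_eq_zero, integral_eq_lintegral_of_nonneg_ae]
    · exact (ENNReal.toReal_eq_one_iff _).2 (ProbabilityTheory.lintegral_betaPDF_eq_one ha0 ha0)
    · refine ae_of_all _ fun x => ?_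
      by_cases hx : 0 < x ∧ x < 1
      · exact (ProbabilityTheory.betaPDFReal_pos hx.1 hx.2 ha0 ha0).le
      · simp [ProbabilityTheory.betaPDFReal, if_neg hx]
    · fun_prop
    · intro x hx
      rw [ProbabilityTheory.betaPDFReal, if_neg fun h => hx h.1]
  rw [h1, Real.rpow_sub_one (by norm_num)]
  simp
  ring

lemma surfArea_pos (d : ℕ) (hd : 2 ≤ d) {r : ℝ} (hr : 0 < r) : 0 < surfArea d r := by
  have : (0 : ℝ) < d := by exact_mod_cast (by lia : 0 < d)
  have := Real.Gamma_pos_of_pos (by positivity : 0 < (d : ℝ) / 2 + 1)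
  unfold surfArea
  positivity

lemma sq_surfArea_one (d : ℕ) (hd : 2 ≤ d) :
    surfArea d 1 * (2 * Real.pi ^ (((d : ℝ) - 1) / 2) / Real.Gamma (((d : ℝ) - 1) / 2) *
      (2⁻¹ * 4 ^ (((d : ℝ) - 1) / 2) *
        ProbabilityTheory.beta (((d : ℝ) - 1) / 2) (((d : ℝ) - 1) / 2))) = surfArea d 1 ^ 2 := by
  set a : ℝ := ((d : ℝ) - 1) / 2 with ha
  have hd' : (2 : ℝ) ≤ d := by exact_mod_cast hd
  have ha0 : 0 < a := by rw [ha]; linarith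
  have hda : (d : ℝ) / 2 = a + 1 / 2 := by rw [ha]; ring
  have h4 : (4 : ℝ) ^ a = 2 ^ (2 * a) := by
    rw [Real.rpow_mul (by norm_num)]; norm_num
  have hdup := Real.Gamma_mul_Gamma_add_half a
  have hpi : Real.pi ^ (a + 1 / 2) = Real.pi ^ a * √Real.pi := by
    rw [Real.rpow_add Real.pi_pos, Real.sqrt_eq_rpow]
  have hG1 := Real.Gamma_pos_of_pos ha0
  have hG2 := Real.Gamma_pos_of_pos (by linarith : 0 < 2 * a)
  have hG3 := Real.Gamma_pos_of_pos (by linarith : 0 < a + 1 / 2)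
  have hd2 : (d : ℝ) = 2 * (a + 1 / 2) := by rw [ha]; ring
  have h22 : (2 : ℝ) ^ (1 - 2 * a) * 2 ^ (2 * a) = 2 := by
    rw [← Real.rpow_add (by norm_num)]; simp
  rw [sq]
  congr 1
  rw [surfArea, hda, hpi, Real.Gamma_add_one (by positivity), h4, ProbabilityTheory.beta, hd2,
    ← two_mul]
  have h2pos : (0 : ℝ) < 2 ^ (2 * a) := by positivity
  have : Real.Gamma a = Real.Gamma (2 * a) * 2 ^ (1 - 2 * a) * √Real.pi / Real.Gamma (a + 1 / 2) := by
    rw [← hdup]; field_simp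
  have hne : a + 1 / 2 ≠ 0 := by positivity
  calc _ = Real.pi ^ a * 2 ^ (2 * a) * Real.Gamma a / Real.Gamma (2 * a) := by
        field_simp
    _ = Real.pi ^ a * √Real.pi * (2 ^ (1 - 2 * a) * 2 ^ (2 * a)) / Real.Gamma (a + 1 / 2) := by
        rw [this]; field_simp
    _ = _ := by rw [h22, one_pow]; field_simp

lemma ae_norm_ne (d : ℕ) (hd : 2 ≤ d) (r : ℝ) :
    ∀ᵐ v : EuclideanSpace ℝ (Fin d), v ≠ 0 ∧ ‖v‖ ≠ r := by
  have : Nonempty (Fin d) := ⟨⟨0, by lia⟩⟩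
  have h1 : ∀ᵐ v : EuclideanSpace ℝ (Fin d), v ≠ 0 :=
    measure_eq_zero_iff_ae_notMem.1 (measure_singleton (0 : EuclideanSpace ℝ (Fin d)))
  have h2 := measure_eq_zero_iff_ae_notMem.1
    (Measure.addHaar_sphere volume (0 : EuclideanSpace ℝ (Fin d)) r)
  filter_upwards [h1, h2] with v hv hv'
  exact ⟨hv, fun h => hv' (by simpa using h)⟩

lemma lintegral_kernelK_one (d : ℕ) (hd : 2 ≤ d) :
    ∫⁻ v, kernelK d 1 v = ENNReal.ofReal (surfArea d 1 ^ 2) := by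
  have hne : Nonempty (Fin d) := ⟨⟨0, by lia⟩⟩
  have : Nontrivial (EuclideanSpace ℝ (Fin d)) := inferInstance
  have hd' : (2 : ℝ) ≤ d := by exact_mod_cast hd
  have hG := Real.Gamma_pos_of_pos (by linarith : 0 < ((d : ℝ) - 1) / 2)
  set C : ℝ := 2 * Real.pi ^ (((d : ℝ) - 1) / 2) / Real.Gamma (((d : ℝ) - 1) / 2) with hC
  set f : ℝ → ℝ := fun y => C * (if y < 2 then
      (1 - y ^ 2 / 4) ^ (((d : ℝ) - 3) / 2) / y else 0) with hf
  have hball : d * volume.real (Metric.ball (0 : EuclideanSpace ℝ (Fin d)) 1) = surfArea d 1 := by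
    rw [Measure.real, EuclideanSpace.volume_ball, surfArea, Fintype.card_fin, ENNReal.ofReal_one,
      one_pow, one_pow, one_mul, ENNReal.toReal_ofReal, mul_one, mul_div_assoc,
      Real.sqrt_eq_rpow, ← Real.rpow_natCast, ← Real.rpow_mul Real.pi_pos.le]
    · congr 3; ring
    · have := Real.Gamma_pos_of_pos (by positivity : 0 < (d : ℝ) / 2 + 1)
      positivity
  have hint : ∫ v : EuclideanSpace ℝ (Fin d), f ‖v‖ = surfArea d 1 ^ 2 := by
    rw [integral_fun_norm_addHaar, finrank_euclideanSpace_fin, nsmul_eq_mul, smul_eq_mul,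
      ← mul_assoc, hball, ← sq_surfArea_one d hd, ← integral_radial_beta d hd, ← hC,
      ← integral_const_mul C]
    refine congrArg (surfArea d 1 * ·) (integral_congr_ae (ae_of_all _ fun y => ?_))
    simp only [hf, smul_eq_mul]
    ring
  have hA := surfArea_pos d hd one_pos
  have hi : Integrable fun v : EuclideanSpace ℝ (Fin d) => f ‖v‖ := by
    apply Integrable.of_integral_ne_zero
    rw [hint]; positivity
  rw [← hint, ofReal_integral_eq_lintegral_ofReal hi]
  · apply lintegral_congr_ae
    filter_upwards [ae_norm_ne d hd 2] with v hv
    simp only [kernelK, hf]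
    rw [if_neg (by simpa using hv)]
    rcases lt_or_gt_of_ne hv.2 with h | h
    · rw [if_neg (by linarith), if_pos h]
      congr 1
      simp only [hC, one_pow, mul_one]
      have := norm_pos_iff.2 hv.1
      field_simp
    · rw [if_pos (by linarith), if_neg h.not_gt]
      simp
  · refine ae_of_all _ fun v => ?_
    simp only [hf]
    have hC0 : 0 ≤ C := by positivity
    refine mul_nonneg hC0 ?_
    split_ifs with h
    · have := norm_nonneg v
      have : 0 ≤ 1 - ‖v‖ ^ 2 / 4 := by nlinarith
      positivity
    · rfl

lemma kernelK_smul (d : ℕ) {r : ℝ} (hr : 0 < r) (hd : 2 ≤ d) (v : EuclideanSpace ℝ (Fin d)) :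
    kernelK d r (r • v) = ENNReal.ofReal (r ^ (d - 2)) * kernelK d 1 v := by
  unfold kernelK
  have hn : ‖r • v‖ = r * ‖v‖ := by rw [norm_smul, Real.norm_of_nonneg hr.le]
  have h1 : (r • v = 0 ∨ ‖r • v‖ = 2 * r) ↔ (v = 0 ∨ ‖v‖ = 2 * 1) := by
    rw [hn, smul_eq_zero_iff_right hr.ne', mul_comm 2 r, mul_right_inj' hr.ne', mul_one]
  have h2 : 2 * r < ‖r • v‖ ↔ 2 * 1 < ‖v‖ := by
    rw [hn, mul_comm 2 r, mul_lt_mul_iff_right₀ hr, mul_one]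
  have hpos : 0 < r ^ (d - 2) := by positivity
  by_cases c1 : v = 0 ∨ ‖v‖ = 2 * 1
  · rw [if_pos c1, if_pos (h1.2 c1), ENNReal.mul_top (by simpa using hpos)]
  rw [if_neg c1, if_neg (mt h1.1 c1)]
  by_cases c2 : 2 * 1 < ‖v‖
  · rw [if_pos c2, if_pos (h2.2 c2), mul_zero]
  rw [if_neg c2, if_neg (mt h2.1 c2), ← ENNReal.ofReal_mul hpos.le, hn]
  congr 1
  push Not at c1 c2
  have hv : 0 < ‖v‖ := norm_pos_iff.2 c1.1
  have h3 : r ^ 2 - (r * ‖v‖) ^ 2 / 4 = r ^ 2 * (1 ^ 2 - ‖v‖ ^ 2 / 4) := by ring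
  have h4 : 0 ≤ 1 ^ 2 - ‖v‖ ^ 2 / 4 := by nlinarith
  have h5 : (r ^ 2) ^ (((d : ℝ) - 3) / 2) * r = r ^ (d - 2) := by
    rw [← Real.rpow_two, ← Real.rpow_mul hr.le, ← Real.rpow_natCast r (d - 2), Nat.cast_sub hd]
    nth_rewrite 2 [← Real.rpow_one r]
    rw [← Real.rpow_add hr]
    congr 1
    push_cast
    ring
  have hd' : (2 : ℝ) ≤ d := by exact_mod_cast hd
  have hG := Real.Gamma_pos_of_pos (by linarith : 0 < ((d : ℝ) - 1) / 2)
  rw [h3, Real.mul_rpow (by positivity) h4, ← h5]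
  field_simp

section Averaging

variable {X : Type*} [NormedAddCommGroup X] [NormedSpace ℝ X] [FiniteDimensional ℝ X]
  [MeasurableSpace X] [BorelSpace X] (μ : Measure X) [μ.IsAddHaarMeasure]

lemma measure_annulus_le (c : X) {S η : ℝ} (hη : 0 ≤ η) (hS : η ≤ S) :
    μ (Metric.closedBall c (S + η) \ Metric.closedBall c (S - η)) ≤
      ENNReal.ofReal (2 * η * Module.finrank ℝ X * (S + η) ^ (Module.finrank ℝ X - 1)) *
        μ (Metric.ball 0 1) := by
  have hfin : μ (Metric.closedBall c (S - η)) ≠ ⊤ := measure_closedBall_lt_top.ne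
  rw [measure_sdiff (Metric.closedBall_subset_closedBall (by linarith))
    Metric.isClosed_closedBall.measurableSet.nullMeasurableSet hfin,
    Measure.addHaar_closedBall _ _ (by linarith), Measure.addHaar_closedBall _ _ (by linarith),
    ← ENNReal.sub_mul fun _ _ => measure_ball_lt_top.ne,
    ← ENNReal.ofReal_sub _ (pow_nonneg (by linarith) _)]
  gcongr
  have h := abs_pow_sub_pow_le (S + η) (S - η) (Module.finrank ℝ X)
  have h2 : S + η - (S - η) = 2 * η := by ring
  rw [h2, abs_of_nonneg (by linarith : 0 ≤ 2 * η), abs_of_nonneg (by linarith : 0 ≤ S + η),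
    abs_of_nonneg (by linarith : 0 ≤ S - η), max_eq_left (by linarith)] at h
  exact (le_abs_self _).trans h

lemma setLIntegral_le_of_measure_inter_closedBall_le {H : X → ENNReal} (hH : Measurable H)
    {C ω M : ENNReal} {η S : ℝ} (hη : 0 < η)
    (hC : ∀ v, H v ≤ C) (hω : ∀ u v, dist u v ≤ η → H u ≤ H v + ω) {c : X} {E : Set X}
    (hES : E ⊆ Metric.closedBall c S)
    (hM : ∀ z, Metric.closedBall z η ⊆ Metric.closedBall c S →
      μ (E ∩ Metric.closedBall z η) ≤ M * μ (Metric.closedBall z η)) (x : X) :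
    ∫⁻ y in E, H (x - y) ∂μ ≤ M * ∫⁻ v, H v ∂μ +
      C * μ (Metric.closedBall c (S + η) \ Metric.closedBall c (S - η)) + ω * μ E := by
  set V := μ (Metric.closedBall (0 : X) η) with hV
  have hVz : ∀ z : X, μ (Metric.closedBall z η) = V := fun z =>
    Measure.addHaar_closedBall_center μ z η
  have hV0 : V ≠ 0 := (Metric.measure_closedBall_pos μ _ hη).ne'
  have hVt : V ≠ ⊤ := measure_closedBall_lt_top.ne
  set T := Metric.closedBall c (S + η) \ Metric.closedBall c (S - η) with hT
  have hTm : MeasurableSet T := Metric.isClosed_closedBall.measurableSet.diff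
    Metric.isClosed_closedBall.measurableSet
  have hdens : ∀ z, μ (E ∩ Metric.closedBall z η) ≤ M * V + T.indicator (fun _ => V) z := by
    intro z
    by_cases hz : dist z c ≤ S - η
    · refine le_add_right ((hM z ?_).trans_eq (by rw [hVz]))
      exact Metric.closedBall_subset_closedBall' (by linarith)
    by_cases hz' : dist z c ≤ S + η
    · rw [Set.indicator_of_mem (show z ∈ T from ⟨hz', hz⟩)]
      exact le_add_left ((measure_mono Set.inter_subset_right).trans_eq (hVz z))
    · have : E ∩ Metric.closedBall z η = ∅ := by
        refine Set.eq_empty_of_forall_notMem fun y hy => hz' ?_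
        have h1 : dist y c ≤ S := hES hy.1
        have h2 : dist y z ≤ η := hy.2
        linarith [dist_triangle_left z c y]
      simp [this]
  have hD : MeasurableSet {p : X × X | dist p.2 p.1 ≤ η} :=
    (isClosed_le (by fun_prop) continuous_const).measurableSet
  set F : X → X → ENNReal := fun y z =>
    {p : X × X | dist p.2 p.1 ≤ η}.indicator (fun p => H (x - p.2)) (y, z) with hF
  have hFm : Measurable (Function.uncurry F) :=
    (hH.comp (measurable_const.sub measurable_snd)).indicator hD
  have hpoint : ∀ y, V * H (x - y) ≤ ∫⁻ z, F y z ∂μ + ω * V := by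
    intro y
    calc V * H (x - y) = ∫⁻ _ in Metric.closedBall y η, H (x - y) ∂μ := by
          rw [setLIntegral_const, hVz, mul_comm]
      _ ≤ ∫⁻ z in Metric.closedBall y η, (H (x - z) + ω) ∂μ := by
          refine setLIntegral_mono' Metric.isClosed_closedBall.measurableSet fun z hz => hω _ _ ?_
          rw [dist_sub_left, dist_comm]
          exact hz
      _ = ∫⁻ z, F y z ∂μ + ω * V := by
          rw [lintegral_add_right _ measurable_const, setLIntegral_const, hVz,
            ← lintegral_indicator Metric.isClosed_closedBall.measurableSet]
          rfl
  have hswap : ∫⁻ y in E, ∫⁻ z, F y z ∂μ ∂μ =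
      ∫⁻ z, H (x - z) * μ (E ∩ Metric.closedBall z η) ∂μ := by
    rw [lintegral_lintegral_swap hFm.aemeasurable]
    refine lintegral_congr fun z => ?_
    have : ∀ y, F y z = (Metric.closedBall z η).indicator (fun _ => H (x - z)) y := by
      intro y
      simp only [hF, Set.indicator_apply, Set.mem_ofPred_eq, Metric.mem_closedBall, dist_comm z y]
    simp_rw [this]
    rw [lintegral_indicator Metric.isClosed_closedBall.measurableSet, setLIntegral_const,
      Measure.restrict_apply Metric.isClosed_closedBall.measurableSet, Set.inter_comm]
  have hHx : Measurable fun z => H (x - z) := hH.comp (measurable_const.sub measurable_id)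
  have hmain : V * ∫⁻ y in E, H (x - y) ∂μ ≤
      V * (M * ∫⁻ v, H v ∂μ + C * μ T + ω * μ E) := by
    calc V * ∫⁻ y in E, H (x - y) ∂μ = ∫⁻ y in E, V * H (x - y) ∂μ :=
          (lintegral_const_mul _ hHx).symm
      _ ≤ ∫⁻ y in E, (∫⁻ z, F y z ∂μ + ω * V) ∂μ := lintegral_mono hpoint
      _ = ∫⁻ z, H (x - z) * μ (E ∩ Metric.closedBall z η) ∂μ + ω * V * μ E := by
          rw [lintegral_add_right _ measurable_const, setLIntegral_const, hswap]
      _ ≤ ∫⁻ z, (M * V * H (x - z) + T.indicator (fun _ => V * C) z) ∂μ + ω * V * μ E := by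
          gcongr with z
          refine (mul_le_mul_right (hdens z) _).trans ?_
          rw [mul_add, mul_comm (H _) (M * V)]
          gcongr
          by_cases hz : z ∈ T
          · simp only [Set.indicator_of_mem hz]
            rw [mul_comm]
            gcongr
            exact hC _
          · simp [Set.indicator_of_notMem hz]
      _ = V * (M * ∫⁻ v, H v ∂μ + C * μ T + ω * μ E) := by
          rw [lintegral_add_left (hHx.const_mul _), lintegral_const_mul _ hHx,
            lintegral_indicator hTm, setLIntegral_const, lintegral_sub_left_eq_self]
          ring
  exact (ENNReal.mul_le_mul_iff_right hV0 hVt).1 hmain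

lemma exists_radius_setLIntegral_le {K : X → ENNReal} (hK : AEMeasurable K μ)
    (hKi : ∫⁻ v, K v ∂μ ≠ ⊤) (M : NNReal) {R δ : ℝ} (hR : 0 < R) (hδ : 0 < δ) :
    ∃ η₀ > 0, ∀ (η S : ℝ) (c : X) (E : Set X), 0 < η → η ≤ η₀ → η ≤ S → S ≤ R →
      E ⊆ Metric.closedBall c S →
      (∀ z, Metric.closedBall z η ⊆ Metric.closedBall c S →
        μ (E ∩ Metric.closedBall z η) ≤ M * μ (Metric.closedBall z η)) →
      ∀ x, ∫⁻ y in E, K (x - y) ∂μ ≤ M * ∫⁻ v, K v ∂μ + ENNReal.ofReal δ := by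
  set n := Module.finrank ℝ X
  set τ : ℝ := δ / (2 * (M + 1)) with hτ
  have hτ0 : 0 < τ := by positivity
  obtain ⟨h, hsupp, hKh, hcont, -⟩ :=
    (integrable_toReal_of_lintegral_ne_top hK hKi).exists_hasCompactSupport_lintegral_sub_le
      (ENNReal.ofReal_pos.2 hτ0).ne'
  obtain ⟨C, hC⟩ := hsupp.exists_bound_of_continuous hcont
  have hC0 : 0 ≤ C := (norm_nonneg _).trans (hC 0)
  set B := μ.real (Metric.ball (0 : X) 1)
  have hB : 0 ≤ B := measureReal_nonneg
  set ω : ℝ := δ / (4 * (μ.real (Metric.closedBall (0 : X) R) + 1)) with hω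
  have hBR : 0 ≤ μ.real (Metric.closedBall (0 : X) R) := measureReal_nonneg
  have hω0 : 0 < ω := by positivity
  obtain ⟨η₁, hη₁, hunif⟩ := Metric.uniformContinuous_iff.1
    (hsupp.uniformContinuous_of_continuous hcont) ω hω0
  set Q : ℝ := C * (2 * n * (R + 1) ^ (n - 1) * B) with hQ
  have hQ0 : 0 ≤ Q := by positivity
  refine ⟨min (η₁ / 2) (min 1 (δ / (4 * (Q + 1)))), by positivity, ?_⟩
  intro η S c E hη hη₀ hηS hSR hES hM x
  have hη1 : η < η₁ := by
    have := hη₀.trans (min_le_left _ _)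
    linarith
  have hη2 : η ≤ 1 := hη₀.trans ((min_le_right _ _).trans (min_le_left _ _))
  have hη3 : η ≤ δ / (4 * (Q + 1)) := hη₀.trans ((min_le_right _ _).trans (min_le_right _ _))
  have hH : Measurable fun v => ‖h v‖ₑ := hcont.measurable.enorm
  have hDm : AEMeasurable (fun v => ‖(K v).toReal - h v‖ₑ) μ :=
    (hK.ennreal_toReal.sub hcont.aemeasurable).enorm
  have hKae : ∀ᵐ v ∂μ, K v = ‖(K v).toReal‖ₑ := by
    filter_upwards [ae_lt_top' hK hKi] with v hv
    rw [Real.enorm_of_nonneg ENNReal.toReal_nonneg, ENNReal.ofReal_toReal hv.ne]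
  have hKle : ∀ᵐ v ∂μ, K v ≤ ‖h v‖ₑ + ‖(K v).toReal - h v‖ₑ := by
    filter_upwards [hKae] with v hv
    calc K v = ‖h v + ((K v).toReal - h v)‖ₑ := by rw [add_sub_cancel]; exact hv
      _ ≤ _ := enorm_add_le _ _
  have hhle : ∫⁻ v, ‖h v‖ₑ ∂μ ≤ ∫⁻ v, K v ∂μ + ENNReal.ofReal τ := by
    calc ∫⁻ v, ‖h v‖ₑ ∂μ ≤ ∫⁻ v, (K v + ‖(K v).toReal - h v‖ₑ) ∂μ := by
          refine lintegral_mono_ae ?_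
          filter_upwards [hKae] with v hv
          calc ‖h v‖ₑ = ‖(K v).toReal - ((K v).toReal - h v)‖ₑ := by rw [sub_sub_cancel]
            _ ≤ ‖(K v).toReal‖ₑ + ‖(K v).toReal - h v‖ₑ := enorm_sub_le
            _ = _ := by rw [← hv]
      _ ≤ _ := by
          rw [lintegral_add_left' hK]
          gcongr
  have hqmp : Measure.QuasiMeasurePreserving (fun y => x - y) μ μ :=
    quasiMeasurePreserving_sub_left_of_right_invariant μ x
  have hsplit : ∫⁻ y in E, K (x - y) ∂μ ≤
      ∫⁻ y in E, ‖h (x - y)‖ₑ ∂μ + ENNReal.ofReal τ := by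
    calc ∫⁻ y in E, K (x - y) ∂μ
        ≤ ∫⁻ y in E, (‖h (x - y)‖ₑ + ‖(K (x - y)).toReal - h (x - y)‖ₑ) ∂μ :=
          lintegral_mono_ae (ae_restrict_of_ae (hqmp.ae hKle))
      _ = ∫⁻ y in E, ‖h (x - y)‖ₑ ∂μ + ∫⁻ y in E, ‖(K (x - y)).toReal - h (x - y)‖ₑ ∂μ :=
          lintegral_add_left (hH.comp (measurable_const.sub measurable_id)) _
      _ ≤ ∫⁻ y in E, ‖h (x - y)‖ₑ ∂μ + ∫⁻ y, ‖(K (x - y)).toReal - h (x - y)‖ₑ ∂μ := by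
          gcongr
          exact Measure.restrict_le_self
      _ ≤ _ := by
          rw [lintegral_sub_left_eq_self (fun v => ‖(K v).toReal - h v‖ₑ) x]
          gcongr
  have havg := setLIntegral_le_of_measure_inter_closedBall_le μ hH (C := ENNReal.ofReal C)
    (ω := ENNReal.ofReal ω) (M := M) hη
    (fun v => by rw [← ofReal_norm]; exact ENNReal.ofReal_le_ofReal (hC v))
    (fun u v huv => by
      have h1 := hunif (huv.trans_lt hη1)
      calc ‖h u‖ₑ = ‖h v + (h u - h v)‖ₑ := by rw [add_sub_cancel]
        _ ≤ ‖h v‖ₑ + ‖h u - h v‖ₑ := enorm_add_le _ _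
        _ ≤ _ := by
          gcongr
          rw [← ofReal_norm, ← dist_eq_norm]
          exact ENNReal.ofReal_le_ofReal h1.le) hES hM x
  have hann : ENNReal.ofReal C * μ (Metric.closedBall c (S + η) \ Metric.closedBall c (S - η)) ≤
      ENNReal.ofReal (δ / 4) := by
    calc _ ≤ ENNReal.ofReal C * (ENNReal.ofReal (2 * η * n * (R + 1) ^ (n - 1)) *
          ENNReal.ofReal B) := by
          gcongr
          refine (measure_annulus_le μ c hη.le hηS).trans ?_
          rw [ofReal_measureReal measure_ball_lt_top.ne]
          gcongr
          linarith
      _ = ENNReal.ofReal (η * Q) := by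
          rw [← ENNReal.ofReal_mul (by positivity), ← ENNReal.ofReal_mul hC0]
          congr 1
          rw [hQ]; ring
      _ ≤ _ := by
          apply ENNReal.ofReal_le_ofReal
          rw [le_div_iff₀ (by positivity)] at hη3
          linarith
  have hωE : ENNReal.ofReal ω * μ E ≤ ENNReal.ofReal (δ / 4) := by
    calc _ ≤ ENNReal.ofReal ω * ENNReal.ofReal (μ.real (Metric.closedBall (0 : X) R)) := by
          gcongr
          rw [ofReal_measureReal measure_closedBall_lt_top.ne,
            ← Measure.addHaar_closedBall_center μ c R]
          exact measure_mono (hES.trans (Metric.closedBall_subset_closedBall hSR))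
      _ ≤ _ := by
          rw [← ENNReal.ofReal_mul hω0.le]
          apply ENNReal.ofReal_le_ofReal
          rw [hω, div_mul_eq_mul_div, div_le_iff₀ (by positivity)]
          linarith
  calc ∫⁻ y in E, K (x - y) ∂μ
      ≤ M * (∫⁻ v, K v ∂μ + ENNReal.ofReal τ) + ENNReal.ofReal (δ / 4) + ENNReal.ofReal (δ / 4) +
          ENNReal.ofReal τ := by
        refine hsplit.trans ?_
        gcongr
        refine havg.trans ?_
        gcongr
    _ = M * ∫⁻ v, K v ∂μ + ENNReal.ofReal δ := by
        have hMτ : (M : ENNReal) * ENNReal.ofReal τ = ENNReal.ofReal (M * τ) := by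
          rw [ENNReal.ofReal_mul M.coe_nonneg, ENNReal.ofReal_coe_nnreal]
        rw [mul_add, hMτ]
        simp only [add_assoc]
        congr 1
        rw [← ENNReal.ofReal_add (by positivity) (by positivity),
          ← ENNReal.ofReal_add (by positivity) (by positivity),
          ← ENNReal.ofReal_add (by positivity) (by positivity)]
        congr 1
        rw [hτ]
        field_simp
        ring

lemma setLIntegral_eq_setLIntegral_preimage_smul {r : ℝ} (hr : 0 < r) (g : X → ENNReal)
    (E : Set X) :
    ∫⁻ y in E, g y ∂μ = ENNReal.ofReal (r ^ Module.finrank ℝ X) *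
      ∫⁻ w in (r • ·) ⁻¹' E, g (r • w) ∂μ := by
  have hemb : MeasurableEmbedding (fun w : X => r • w) :=
    (Homeomorph.smulOfNeZero r hr.ne').measurableEmbedding
  have hrn : 0 < r ^ Module.finrank ℝ X := by positivity
  rw [← hemb.lintegral_map, ← hemb.restrict_map, Measure.map_addHaar_smul μ hr.ne',
    Measure.restrict_smul, lintegral_smul_measure, smul_eq_mul, ← mul_assoc,
    ← ENNReal.ofReal_mul hrn.le, abs_of_pos (inv_pos.2 hrn), mul_inv_cancel₀ hrn.ne',
    ENNReal.ofReal_one, one_mul]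

end Averaging

lemma measurable_kernelK (d : ℕ) (r : ℝ) : Measurable (kernelK d r) := by
  unfold kernelK
  refine Measurable.ite ?_ measurable_const (Measurable.ite ?_ measurable_const (by fun_prop))
  · exact (measurableSet_singleton 0).union (measurableSet_eq_fun measurable_norm measurable_const)
  · exact measurableSet_lt measurable_const measurable_norm

lemma surfArea_eq_pow_mul (d : ℕ) (r : ℝ) : surfArea d r = r ^ (d - 1) * surfArea d 1 := by
  simp only [surfArea, one_pow]
  ring

lemma setLIntegral_kernelK (d : ℕ) (hd : 2 ≤ d) {r : ℝ} (hr : 0 < r)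
    (E : Set (EuclideanSpace ℝ (Fin d))) (x : EuclideanSpace ℝ (Fin d)) :
    ∫⁻ y in E, kernelK d r (x - y) = ENNReal.ofReal ((r ^ (d - 1)) ^ 2) *
      ∫⁻ w in (r • ·) ⁻¹' E, kernelK d 1 (r⁻¹ • x - w) := by
  have hx : ∀ w, x - r • w = r • (r⁻¹ • x - w) := fun w => by
    rw [smul_sub, smul_inv_smul₀ hr.ne']
  have hpow : r ^ d * r ^ (d - 2) = (r ^ (d - 1)) ^ 2 := by
    rw [← pow_add, ← pow_mul]
    congr 1
    lia
  rw [setLIntegral_eq_setLIntegral_preimage_smul volume hr, finrank_euclideanSpace_fin]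
  simp_rw [hx, kernelK_smul d hr hd]
  have hm : Measurable fun w => kernelK d 1 (r⁻¹ • x - w) :=
    (measurable_kernelK d 1).comp (measurable_const.sub measurable_id)
  rw [lintegral_const_mul _ hm, ← mul_assoc, ← ENNReal.ofReal_mul (by positivity), hpow]

/-- Given `ρ, α, δ > 0`, `0 < ε₀ < 1` and `0 < ξ ≤ 1`, there is `λ ∈ (0, ε₀)` such that:
for any closed ball `B_s` of radius `s > 0` and any measurable `E ⊆ B_s` whose density in
every closed ball `B ⊆ B_s` of radius at least `λs` is less than `ρ(1+α)`, one has, for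
all `ε ∈ [ξε₀, ε₀]`,
`∫_E ∫_E K_{εs}^{(d)}(x-y) dx dy < (A_{εs}^d)² (1+ε)^d ((1+α)²ρ² + δ) 𝓛^d(B_s)`. -/
theorem kernel_integral_bound (d : ℕ) (hd : 2 ≤ d)
    (ρ α δ ε₀ ξ : ℝ) (hρ : 0 < ρ) (hα : 0 < α) (hδ : 0 < δ)
    (hε₀ : 0 < ε₀) (hε₀1 : ε₀ < 1) (hξ : 0 < ξ) (hξ1 : ξ ≤ 1) :
    ∃ lam : ℝ, lam ∈ Set.Ioo 0 ε₀ ∧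
      ∀ (s : ℝ), 0 < s → ∀ c : EuclideanSpace ℝ (Fin d),
        ∀ E : Set (EuclideanSpace ℝ (Fin d)), E ⊆ Metric.closedBall c s → MeasurableSet E →
        (∀ (c' : EuclideanSpace ℝ (Fin d)) (r' : ℝ), lam * s ≤ r' →
          Metric.closedBall c' r' ⊆ Metric.closedBall c s →
          volume (E ∩ Metric.closedBall c' r') / volume (Metric.closedBall c' r') <
            ENNReal.ofReal (ρ * (1 + α))) →
        ∀ ε ∈ Set.Icc (ξ * ε₀) ε₀,
          (∫⁻ x in E, ∫⁻ y in E, kernelK d (ε * s) (x - y)) <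
            ENNReal.ofReal
              ((surfArea d (ε * s)) ^ 2 * (1 + ε) ^ d * ((1 + α) ^ 2 * ρ ^ 2 + δ)) *
              volume (Metric.closedBall c s) := by
  set M : ℝ := ρ * (1 + α) with hM
  have hM0 : 0 < M := by positivity
  set A : ℝ := surfArea d 1 with hA
  have hA0 : 0 < A := surfArea_pos d hd one_pos
  have hξε : 0 < ξ * ε₀ := by positivity
  obtain ⟨η₀, hη₀, hη⟩ := exists_radius_setLIntegral_le
    (volume : Measure (EuclideanSpace ℝ (Fin d))) (measurable_kernelK d 1).aemeasurable
    (by rw [lintegral_kernelK_one d hd]; exact ENNReal.ofReal_ne_top) M.toNNReal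
    (inv_pos.2 hξε) (by positivity : 0 < A ^ 2 * (δ / (2 * M)))
  refine ⟨min (η₀ * (ξ * ε₀)) (ε₀ / 2), ⟨by positivity,
    (min_le_right _ _).trans_lt (by linarith)⟩, ?_⟩
  set lam : ℝ := min (η₀ * (ξ * ε₀)) (ε₀ / 2) with hlam
  have hlam0 : 0 < lam := by positivity
  have hlam1 : lam ≤ 1 := (min_le_right _ _).trans (by linarith)
  intro s hs c E hEs hE hdens ε hε
  have hε0 : 0 < ε := hξε.trans_le hε.1
  set r : ℝ := ε * s with hr
  have hr0 : 0 < r := by positivity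
  have hdens' : ∀ (c' : EuclideanSpace ℝ (Fin d)) (r' : ℝ), lam * s ≤ r' →
      Metric.closedBall c' r' ⊆ Metric.closedBall c s →
      volume (E ∩ Metric.closedBall c' r') ≤
        ENNReal.ofReal M * volume (Metric.closedBall c' r') := by
    intro c' r' hr' hsub
    have hr'0 : 0 < r' := (by positivity : 0 < lam * s).trans_le hr'
    exact (ENNReal.div_le_iff (Metric.measure_closedBall_pos volume c' hr'0).ne'
      measure_closedBall_lt_top.ne).1 (hdens c' r' hr' hsub).le
  have hpre : ∀ (z : EuclideanSpace ℝ (Fin d)) (t : ℝ),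
      (r • ·) ⁻¹' Metric.closedBall (r • z) (r * t) = Metric.closedBall z t := by
    intro z t
    ext w
    rw [Set.mem_preimage, Metric.mem_closedBall, Metric.mem_closedBall, dist_smul₀,
      Real.norm_of_nonneg hr0.le, mul_le_mul_iff_right₀ hr0]
  have hc : r • r⁻¹ • c = c := smul_inv_smul₀ hr0.ne' c
  have hrs : r * ε⁻¹ = s := by rw [hr]; field_simp
  have hrl : r * (lam / ε) = lam * s := by rw [hr]; field_simp
  have hpreB : (r • ·) ⁻¹' Metric.closedBall c s = Metric.closedBall (r⁻¹ • c) ε⁻¹ := by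
    rw [← hpre (r⁻¹ • c), hc, hrs]
  have hbound : ∀ x, ∫⁻ w in (r • ·) ⁻¹' E, kernelK d 1 (x - w) ≤
      ENNReal.ofReal (A ^ 2 * (M + δ / (2 * M))) := by
    intro x
    refine (hη (lam / ε) ε⁻¹ (r⁻¹ • c) _ (by positivity) ?_ ?_ ?_ ?_ ?_ x).trans_eq ?_
    · rw [div_le_iff₀ hε0]
      exact (min_le_left _ _).trans (by gcongr; exact hε.1)
    · rw [div_eq_mul_inv]
      exact mul_le_of_le_one_left (by positivity) hlam1
    · exact inv_anti₀ hξε hε.1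
    · rw [← hpreB]
      exact Set.preimage_mono hEs
    · intro z hz
      have hz' : Metric.closedBall (r • z) (lam * s) ⊆ Metric.closedBall c s := by
        rw [← hpre, ← hpreB, hrl] at hz
        exact (Function.Surjective.preimage_subset_preimage_iff
          (fun y => ⟨r⁻¹ • y, smul_inv_smul₀ hr0.ne' y⟩)).1 hz
      rw [← hpre, ← Set.preimage_inter, Measure.addHaar_preimage_smul _ hr0.ne',
        Measure.addHaar_preimage_smul _ hr0.ne', mul_left_comm, hrl]
      gcongr
      exact hdens' _ _ le_rfl hz'
    · rw [lintegral_kernelK_one d hd]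
      change ENNReal.ofReal M * _ + _ = _
      rw [← ENNReal.ofReal_mul hM0.le, ← ENNReal.ofReal_add (by positivity) (by positivity)]
      congr 1
      ring
  have hEvol : volume E ≤ ENNReal.ofReal M * volume (Metric.closedBall c s) := by
    have := hdens' c s (mul_le_of_le_one_left hs.le hlam1) subset_rfl
    rwa [Set.inter_eq_left.2 hEs] at this
  have hpow : 0 < r ^ (d - 1) := by positivity
  calc ∫⁻ x in E, ∫⁻ y in E, kernelK d r (x - y)
      ≤ ∫⁻ _ in E, ENNReal.ofReal ((r ^ (d - 1)) ^ 2) *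
          ENNReal.ofReal (A ^ 2 * (M + δ / (2 * M))) := by
        refine lintegral_mono fun x => ?_
        rw [setLIntegral_kernelK d hd hr0]
        gcongr
        exact hbound _
    _ ≤ ENNReal.ofReal ((r ^ (d - 1)) ^ 2) * ENNReal.ofReal (A ^ 2 * (M + δ / (2 * M))) *
          (ENNReal.ofReal M * volume (Metric.closedBall c s)) := by
        rw [setLIntegral_const]
        gcongr
    _ = ENNReal.ofReal ((r ^ (d - 1) * A) ^ 2 * (M ^ 2 + δ / 2)) *
          volume (Metric.closedBall c s) := by
        rw [← ENNReal.ofReal_mul (by positivity), ← mul_assoc,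
          ← ENNReal.ofReal_mul (by positivity)]
        congr 2
        field_simp
    _ < _ := by
        refine (ENNReal.mul_lt_mul_iff_left (Metric.measure_closedBall_pos volume c hs).ne'
          measure_closedBall_lt_top.ne).2 ?_
        rw [surfArea_eq_pow_mul d r, ← hA]
        refine (ENNReal.ofReal_lt_ofReal_iff (by positivity)).2 ?_
        have h1 : (1 : ℝ) ≤ (1 + ε) ^ d := one_le_pow₀ (by linarith)
        have h2 : (1 + α) ^ 2 * ρ ^ 2 = M ^ 2 := by rw [hM]; ring
        rw [h2, mul_assoc]
        gcongr
        calc M ^ 2 + δ / 2 < 1 * (M ^ 2 + δ) := by linarith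
          _ ≤ _ := by gcongr
end

section
/- Let z = (−1 + √5)/2, let r > 0 be such that r² − z ∈ ℤ, let A, B ∈ ℝ, and define the sequence a_k := r² k² + A k + B (mod 1) on the torus ℝ/ℤ. Then for every integer n > 10^5 (more precisely, every n ≥ 2 with 10 (log n)/n^{1/5} < 1), the discrepancy of the first n terms satisfies D_n(a) < 10 (log n)/n^{1/5}, where the logarithm has base e. -/
/-- The discrepancy of the first `n` terms of the sequence `(a_k mod 1)_k` on the torus
`ℝ/ℤ ≡ [0,1)`: the supremum over half-open intervals `[α,β) ⊆ [0,1)` of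
`|card{k < n : a_k mod 1 ∈ [α,β)}/n - (β-α)|`. -/
noncomputable def discrepancy (n : ℕ) (a : ℕ → ℝ) : ℝ :=
  sSup {t : ℝ | ∃ α β : ℝ, 0 ≤ α ∧ α ≤ β ∧ β ≤ 1 ∧
    t = |(({k : ℕ | k < n ∧ Int.fract (a k) ∈ Set.Ico α β}.ncard : ℝ)) / (n : ℝ) - (β - α)|}

open Real

theorem one_div_three_mul_le_abs_mul_golden_sub (p q : ℤ) (hq : q ≠ 0) :
    1 / (3 * |(q : ℝ)|) ≤ |q * ((-1 + √5) / 2) - p| := by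
  have h5 : √5 ^ 2 = 5 := Real.sq_sqrt (by norm_num)
  have h5n : 0 ≤ √5 := Real.sqrt_nonneg 5
  have h5u : √5 < 2.24 := by
    rw [Real.sqrt_lt' (by norm_num)]; norm_num
  have hqpos : (1 : ℝ) ≤ |(q : ℝ)| := by exact_mod_cast Int.one_le_abs hq
  have hirr : Irrational (√5) := by
    simpa using Nat.Prime.irrational_sqrt (show Nat.Prime 5 by norm_num)
  have hprod : (q * ((-1 + √5) / 2) - p) * (q * ((-1 - √5) / 2) - p)
      = ((p ^ 2 + p * q - q ^ 2 : ℤ) : ℝ) := by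
    push_cast
    linear_combination (-(q : ℝ) ^ 2 / 4) * h5
  have hne : p ^ 2 + p * q - q ^ 2 ≠ 0 := by
    intro h0
    rw [h0, Int.cast_zero, mul_eq_zero] at hprod
    have hq' : (q : ℝ) ≠ 0 := by exact_mod_cast hq
    refine hirr ?_
    rcases hprod with h | h
    · refine ⟨(2 * p + q) / q, ?_⟩
      push_cast
      field_simp
      linear_combination (-2) * h
    · refine ⟨-((2 * p + q) / q), ?_⟩
      push_cast
      field_simp
      linear_combination (2) * h
  have hone : (1 : ℝ) ≤ |((p ^ 2 + p * q - q ^ 2 : ℤ) : ℝ)| := by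
    exact_mod_cast Int.one_le_abs hne
  rw [← hprod, abs_mul] at hone
  set t := (q : ℝ) * ((-1 + √5) / 2) - p with ht
  have hconj : |(q : ℝ) * ((-1 - √5) / 2) - p| ≤ |t| + |(q : ℝ)| * √5 := by
    have : (q : ℝ) * ((-1 - √5) / 2) - p = t - q * √5 := by rw [ht]; ring
    rw [this]
    calc _ ≤ |t| + |(q : ℝ) * √5| := abs_sub _ _
      _ = _ := by rw [abs_mul, abs_of_nonneg h5n]
  by_contra! hlt
  rw [lt_div_iff₀ (by positivity)] at hlt
  have h1 := hone.trans (mul_le_mul_of_nonneg_left hconj (abs_nonneg t))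
  have h2 : |t| ≤ 1 / 3 := by nlinarith [abs_nonneg t]
  nlinarith [abs_nonneg t]

theorem four_mul_le_norm_fourierChar_sub_one {θ c : ℝ} (h : ∀ p : ℤ, c ≤ |θ - p|) :
    4 * c ≤ ‖(Real.fourierChar θ : ℂ) - 1‖ := by
  set φ := θ - round θ with hφ
  have hper : (Real.fourierChar θ : ℂ) = Complex.exp (Complex.I * ((2 * π * φ : ℝ) : ℂ)) := by
    rw [Real.fourierChar_apply, Complex.exp_eq_exp_iff_exists_int]
    refine ⟨round θ, ?_⟩
    rw [hφ]
    push_cast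
    ring
  have hφ' : |φ| ≤ 1 / 2 := abs_sub_round θ
  have hsin := Real.mul_abs_le_abs_sin (x := π * φ) (by
    rw [abs_mul, abs_of_pos Real.pi_pos]; nlinarith [Real.pi_pos])
  rw [abs_mul, abs_of_pos Real.pi_pos] at hsin
  rw [hper, Complex.norm_exp_I_mul_ofReal_sub_one, norm_mul, Real.norm_eq_abs, Real.norm_eq_abs,
    show 2 * π * φ / 2 = π * φ by ring, abs_two]
  have h2 : 2 / π * (π * |φ|) = 2 * |φ| := by field_simp
  linarith [h (round θ)]

theorem norm_sum_fourierChar_linear_le {θ c : ℝ} (hc : 0 < c) (h : ∀ p : ℤ, c ≤ |θ - p|)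
    (γ : ℝ) (n : ℕ) :
    ‖∑ k ∈ Finset.range n, (Real.fourierChar (k * θ + γ) : ℂ)‖ ≤ 1 / (2 * c) := by
  have hterm : ∀ k : ℕ, (Real.fourierChar (k * θ + γ) : ℂ)
      = (Real.fourierChar θ : ℂ) ^ k * (Real.fourierChar γ : ℂ) := by
    intro k
    rw [AddChar.map_add_eq_mul, ← nsmul_eq_mul, AddChar.map_nsmul_eq_pow]
    push_cast
    rfl
  simp_rw [hterm]
  rw [← Finset.sum_mul, norm_mul, Circle.norm_coe, mul_one]
  have hgeom := congrArg norm (geom_sum_mul (Real.fourierChar θ : ℂ) n)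
  rw [norm_mul] at hgeom
  have hle : ‖(Real.fourierChar θ : ℂ) ^ n - 1‖ ≤ 2 := by
    refine (norm_sub_le _ _).trans ?_
    rw [norm_pow, Circle.norm_coe, norm_one, one_pow]
    norm_num
  have h4 := four_mul_le_norm_fourierChar_sub_one h
  rw [le_div_iff₀ (by positivity)]
  nlinarith [norm_nonneg (∑ k ∈ Finset.range n, (Real.fourierChar θ : ℂ) ^ k)]

theorem norm_sum_range_shift_sub_le {v : ℕ → ℂ} (hv : ∀ k, ‖v k‖ ≤ 1) (n j : ℕ) :
    ‖∑ k ∈ Finset.range n, v (k + j) - ∑ k ∈ Finset.range n, v k‖ ≤ 2 * j := by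
  induction j with
  | zero => simp
  | succ j ih =>
    have hstep : ∑ k ∈ Finset.range n, v (k + (j + 1)) - ∑ k ∈ Finset.range n, v (k + j)
        = v (n + j) - v j := by
      rw [← Finset.sum_sub_distrib]
      have := Finset.sum_range_sub (fun k => v (k + j)) n
      simp only [zero_add] at this
      rw [← this]
      refine Finset.sum_congr rfl fun k _ => ?_
      rw [show k + (j + 1) = k + 1 + j by ring]
    calc _ = ‖(v (n + j) - v j)
          + (∑ k ∈ Finset.range n, v (k + j) - ∑ k ∈ Finset.range n, v k)‖ := by
          rw [← hstep]; congr 1; ring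
      _ ≤ ‖v (n + j)‖ + ‖v j‖ + 2 * j :=
          (norm_add_le _ _).trans (add_le_add (norm_sub_le _ _) ih)
      _ ≤ _ := by push_cast; linarith [hv (n + j), hv j]

/-- A form of the van der Corput inequality. -/
theorem van_der_corput {v : ℕ → ℂ} (hv : ∀ k, ‖v k‖ ≤ 1) (n H : ℕ) {K : ℝ} (hK0 : 0 ≤ K)
    (hK : ∀ i < H, ∀ j < H, i ≠ j →
      ‖∑ k ∈ Finset.range n, v (k + i) * (starRingEnd ℂ) (v (k + j))‖ ≤ K) :
    H * ‖∑ k ∈ Finset.range n, v k‖ ≤ 2 * H ^ 2 + √(n * (H * n + H ^ 2 * K)) := by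
  have hsq : (((∑ k ∈ Finset.range n, ‖∑ j ∈ Finset.range H, v (k + j)‖ ^ 2 : ℝ)) : ℂ)
      = ∑ i ∈ Finset.range H, ∑ j ∈ Finset.range H,
        ∑ k ∈ Finset.range n, v (k + i) * (starRingEnd ℂ) (v (k + j)) := by
    push_cast
    simp_rw [← Complex.mul_conj', map_sum, Finset.sum_mul_sum]
    rw [Finset.sum_comm]
    refine Finset.sum_congr rfl fun i _ => ?_
    rw [Finset.sum_comm]
  have hdouble : ∑ k ∈ Finset.range n, ‖∑ j ∈ Finset.range H, v (k + j)‖ ^ 2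
      ≤ H * n + H ^ 2 * K := by
    rw [← Complex.norm_of_nonneg (Finset.sum_nonneg fun k _ => sq_nonneg _), hsq]
    refine (norm_sum_le _ _).trans ?_
    have hrow : ∀ i ∈ Finset.range H, ‖∑ j ∈ Finset.range H,
        ∑ k ∈ Finset.range n, v (k + i) * (starRingEnd ℂ) (v (k + j))‖ ≤ n + H * K := by
      intro i hi
      refine (norm_sum_le _ _).trans ?_
      have hentry : ∀ j ∈ Finset.range H,
          ‖∑ k ∈ Finset.range n, v (k + i) * (starRingEnd ℂ) (v (k + j))‖
            ≤ (if i = j then (n : ℝ) else 0) + K := by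
        intro j hj
        split_ifs with hij
        · subst hij
          refine le_add_of_le_of_nonneg ?_ hK0
          refine (norm_sum_le_of_le _ (n := fun _ => (1 : ℝ)) fun k _ => ?_).trans (by simp)
          rw [norm_mul, RCLike.norm_conj]
          exact mul_le_one₀ (hv _) (norm_nonneg _) (hv _)
        · rw [zero_add]
          exact hK i (Finset.mem_range.1 hi) j (Finset.mem_range.1 hj) hij
      refine (Finset.sum_le_sum hentry).trans ?_
      rw [Finset.sum_add_distrib, Finset.sum_ite_eq, if_pos hi]
      simp
    refine (Finset.sum_le_sum hrow).trans ?_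
    rw [Finset.sum_const, Finset.card_range, nsmul_eq_mul]
    exact le_of_eq (by ring)
  have hcs : ‖∑ k ∈ Finset.range n, ∑ j ∈ Finset.range H, v (k + j)‖ ^ 2
      ≤ n * ∑ k ∈ Finset.range n, ‖∑ j ∈ Finset.range H, v (k + j)‖ ^ 2 := by
    have h1 := norm_sum_le (Finset.range n) (fun k => ∑ j ∈ Finset.range H, v (k + j))
    refine (pow_le_pow_left₀ (norm_nonneg _) h1 2).trans ?_
    simpa using sq_sum_le_card_mul_sum_sq (s := Finset.range n)
      (f := fun k => ‖∑ j ∈ Finset.range H, v (k + j)‖)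
  have hshift : ‖∑ k ∈ Finset.range n, ∑ j ∈ Finset.range H, v (k + j)
      - H * ∑ k ∈ Finset.range n, v k‖ ≤ 2 * H ^ 2 := by
    have hconst : H * ∑ k ∈ Finset.range n, v k
        = ∑ _j ∈ Finset.range H, ∑ k ∈ Finset.range n, v k := by simp
    rw [Finset.sum_comm, hconst, ← Finset.sum_sub_distrib]
    refine (norm_sum_le_of_le _ (n := fun _ => (2 * H : ℝ)) fun j hj => ?_).trans ?_
    · refine (norm_sum_range_shift_sub_le hv n j).trans ?_
      have : (j : ℝ) ≤ H := by exact_mod_cast (Finset.mem_range.1 hj).le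
      linarith
    · rw [Finset.sum_const, Finset.card_range, nsmul_eq_mul]
      exact le_of_eq (by ring)
  have hmain : ‖∑ k ∈ Finset.range n, ∑ j ∈ Finset.range H, v (k + j)‖
      ≤ √(n * (H * n + H ^ 2 * K)) :=
    Real.le_sqrt_of_sq_le (hcs.trans (mul_le_mul_of_nonneg_left hdouble (Nat.cast_nonneg n)))
  have htri := norm_sub_norm_le (H * ∑ k ∈ Finset.range n, v k)
    (∑ k ∈ Finset.range n, ∑ j ∈ Finset.range H, v (k + j))
  rw [norm_sub_rev, norm_mul, Complex.norm_natCast] at htri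
  linarith

theorem norm_sum_fourierChar_quadratic_le {α : ℝ}
    (hα : ∀ p q : ℤ, q ≠ 0 → 1 / (3 * |(q : ℝ)|) ≤ |q * α - p|) (A B : ℝ) {n h : ℕ}
    (hn : 0 < n) (hh : 0 < h) {u : ℝ} (hu : 0 ≤ u) (hun : u ^ 4 * n = h) :
    ‖∑ k ∈ Finset.range n, (Real.fourierChar (h * (α * k ^ 2 + A * k + B)) : ℂ)‖
      ≤ 7 * n * u := by
  have hn' : (1 : ℝ) ≤ n := by exact_mod_cast hn
  have hh' : (1 : ℝ) ≤ h := by exact_mod_cast hh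
  have hu0 : 0 < u := by
    refine hu.lt_of_ne fun h0 => ?_
    rw [← h0] at hun
    simp at hun
    linarith
  set v : ℕ → ℂ := fun k => (Real.fourierChar (h * (α * k ^ 2 + A * k + B)) : ℂ) with hv
  have hv1 : ∀ k, ‖v k‖ ≤ 1 := fun k => (Circle.norm_coe _).le
  change ‖∑ k ∈ Finset.range n, v k‖ ≤ _
  rcases le_or_gt 1 u with h1 | h1
  · refine (norm_sum_le_of_le _ fun k _ => hv1 k).trans ?_
    simp only [Finset.sum_const, Finset.card_range, nsmul_eq_mul, mul_one]
    nlinarith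
  set H := ⌈1 / u ^ 2⌉₊ with hH
  have hinv : 1 ≤ 1 / u ^ 2 := by
    rw [le_div_iff₀ (by positivity)]; nlinarith
  have hHl : 1 / u ^ 2 ≤ H := Nat.le_ceil _
  have hHu : (H : ℝ) ≤ 2 / u ^ 2 := by
    have := Nat.ceil_lt_add_one (zero_le_one.trans hinv)
    rw [show 2 / u ^ 2 = 1 / u ^ 2 + 1 / u ^ 2 by ring]
    linarith
  have hH0 : (0 : ℝ) < H := by linarith
  have hvdc := van_der_corput hv1 n H (K := 3 * h * H) (by positivity) ?_
  · rw [div_le_iff₀ (by positivity)] at hHl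
    rw [le_div_iff₀ (by positivity)] at hHu
    have hsqrt : √(n * (H * n + H ^ 2 * (3 * h * H))) ≤ H * (3 * n * u) := by
      refine Real.sqrt_le_iff.2 ⟨by positivity, ?_⟩
      rw [← hun]
      have e1 : (H : ℝ) * n ^ 2 * 1 ≤ H * n ^ 2 * (H * u ^ 2) :=
        mul_le_mul_of_nonneg_left hHl (by positivity)
      have e2 : 3 * (H : ℝ) ^ 2 * n ^ 2 * u ^ 2 * (H * u ^ 2)
          ≤ 3 * (H : ℝ) ^ 2 * n ^ 2 * u ^ 2 * 2 :=
        mul_le_mul_of_nonneg_left hHu (by positivity)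
      have e3 : 0 ≤ (H : ℝ) ^ 2 * n ^ 2 * u ^ 2 := by positivity
      nlinarith
    have hedge : 2 * (H : ℝ) ≤ 4 * n * u := by
      have e1 : 1 ≤ n * u ^ 3 := by
        have : u ^ 4 ≤ u ^ 3 := pow_le_pow_of_le_one hu h1.le (by norm_num)
        nlinarith
      have e2 : (H : ℝ) * u ^ 2 ≤ 2 * n * u * u ^ 2 := by nlinarith
      have := le_of_mul_le_mul_right e2 (by positivity)
      linarith
    refine le_of_mul_le_mul_left (hvdc.trans ?_) hH0
    nlinarith
  · intro i hi j hj hij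
    have hq : (2 * (h : ℤ) * ((i : ℤ) - j)) ≠ 0 := by
      have : (i : ℤ) - j ≠ 0 := by omega
      have : (h : ℤ) ≠ 0 := by omega
      positivity
    set q : ℤ := 2 * (h : ℤ) * ((i : ℤ) - j) with hqdef
    have hqpos : 0 < |(q : ℝ)| := abs_pos.2 (by exact_mod_cast hq)
    have hphase : ∀ k : ℕ, v (k + i) * (starRingEnd ℂ) (v (k + j))
        = (Real.fourierChar (k * (q * α)
          + h * (α * ((i : ℝ) ^ 2 - (j : ℝ) ^ 2) + A * ((i : ℝ) - j))) : ℂ) := by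
      intro k
      rw [hv, ← Circle.coe_inv_eq_conj, ← AddChar.map_neg_eq_inv, ← Circle.coe_mul,
        ← AddChar.map_add_eq_mul, hqdef]
      congr 2
      push_cast
      ring
    simp_rw [hphase]
    refine (norm_sum_fourierChar_linear_le (by positivity) (fun p => hα p q hq) _ n).trans ?_
    have hqle : |(q : ℝ)| ≤ 2 * h * H := by
      have hij' : |((i : ℤ) - j)| ≤ H := by
        rw [abs_le]; omega
      have : |q| ≤ 2 * h * H := by
        rw [hqdef, abs_mul, abs_of_nonneg (by positivity : (0 : ℤ) ≤ 2 * h)]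
        exact mul_le_mul_of_nonneg_left hij' (by positivity)
      exact_mod_cast this
    rw [show 1 / (2 * (1 / (3 * |(q : ℝ)|))) = 3 / 2 * |(q : ℝ)| by field_simp]
    linarith

theorem sqrt_sqrt_pow_four {x : ℝ} (hx : 0 ≤ x) : √(√x) ^ 4 = x := by
  rw [show √(√x) ^ 4 = (√(√x) ^ 2) ^ 2 by ring, Real.sq_sqrt (Real.sqrt_nonneg x), Real.sq_sqrt hx]

theorem one_div_cube_le_of_pow_four_eq {a b : ℝ} (ha : 0 < a) (hb : 0 ≤ b)
    (hab : a ^ 4 = b ^ 4 + 1) : 1 / a ^ 3 ≤ 4 * (a - b) := by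
  have hba : b ≤ a := by
    refine le_of_pow_le_pow_left₀ (n := 4) (by norm_num) ha.le ?_
    linarith
  rw [div_le_iff₀ (by positivity)]
  have h1 : b ^ 2 ≤ a ^ 2 := pow_le_pow_left₀ hb hba 2
  have h2 : b ^ 3 ≤ a ^ 3 := pow_le_pow_left₀ hb hba 3
  have h3 : a ^ 3 + a ^ 2 * b + a * b ^ 2 + b ^ 3 ≤ 4 * a ^ 3 := by
    nlinarith [mul_le_mul_of_nonneg_left hba (sq_nonneg a), mul_le_mul_of_nonneg_left h1 ha.le]
  nlinarith [mul_le_mul_of_nonneg_left h3 (sub_nonneg.2 hba)]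

theorem one_div_pow_seven_le_of_pow_four_eq {a b : ℝ} (ha : 0 < a) (hb : 0 < b)
    (hab : a ^ 4 = b ^ 4 + 1) : 1 / a ^ 7 ≤ 4 / 3 * (1 / b ^ 3 - 1 / a ^ 3) := by
  have hba : b ≤ a := by
    refine le_of_pow_le_pow_left₀ (n := 4) (by norm_num) ha.le ?_
    linarith
  have h1 := one_div_cube_le_of_pow_four_eq ha hb.le hab
  have h2 : 3 * b ^ 2 * (a - b) ≤ a ^ 3 - b ^ 3 := by
    nlinarith [mul_nonneg (sub_nonneg.2 hba)
      (mul_nonneg (sub_nonneg.2 hba) (by linarith : 0 ≤ a + 2 * b))]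
  have h3 : 1 / b ^ 3 - 1 / a ^ 3 = (a ^ 3 - b ^ 3) / (a ^ 3 * b ^ 3) := by
    field_simp
  have h4 : 3 / 4 * (1 / a ^ 7) ≤ 3 * b ^ 2 * (1 / (4 * a ^ 3)) / (a ^ 3 * b ^ 3) := by
    rw [show 3 * b ^ 2 * (1 / (4 * a ^ 3)) / (a ^ 3 * b ^ 3) = 3 / 4 * (1 / (a ^ 6 * b)) by
      field_simp]
    have : a ^ 6 * b ≤ a ^ 7 := by
      rw [pow_succ a 6]
      exact mul_le_mul_of_nonneg_left hba (by positivity)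
    gcongr
  have h5 : 3 * b ^ 2 * (1 / (4 * a ^ 3)) / (a ^ 3 * b ^ 3)
      ≤ (a ^ 3 - b ^ 3) / (a ^ 3 * b ^ 3) := by
    gcongr
    refine le_trans ?_ h2
    gcongr
    rw [show 1 / (4 * a ^ 3) = 1 / a ^ 3 / 4 by field_simp]
    linarith
  rw [h3]
  linarith

theorem sum_range_le_of_le_fourth_root {f : ℕ → ℝ} {a b : ℝ} (ha : 0 ≤ a) (hb : 0 ≤ b)
    (h0 : f 0 = 0) (hfa : ∀ h : ℕ, 0 < h → f h ≤ a * (1 / √(√h) ^ 3))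
    (hfb : ∀ h : ℕ, 0 < h → f h ≤ b * (1 / √(√h) ^ 7)) {M : ℕ} (hM : 0 < M) (N : ℕ) :
    ∑ h ∈ Finset.range N, f h ≤ (4 * a * M + 4 / 3 * b) / √(√M) ^ 3 := by
  have hpos : ∀ h : ℕ, 0 < h → 0 < √(√(h : ℝ)) := fun h hh =>
    Real.sqrt_pos.2 (Real.sqrt_pos.2 (by exact_mod_cast hh))
  have hstep : ∀ h : ℕ, √(√((h + 1 : ℕ) : ℝ)) ^ 4 = √(√(h : ℝ)) ^ 4 + 1 := fun h => by
    rw [sqrt_sqrt_pow_four (Nat.cast_nonneg _), sqrt_sqrt_pow_four (Nat.cast_nonneg _)]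
    push_cast; ring
  have hlow : ∀ N : ℕ, ∑ h ∈ Finset.range (N + 1), f h ≤ 4 * a * √(√N) := by
    intro N
    induction N with
    | zero => simp [h0]
    | succ N ih =>
      rw [Finset.sum_range_succ]
      have h1 := hfa (N + 1) N.succ_pos
      have h2 := one_div_cube_le_of_pow_four_eq (hpos (N + 1) N.succ_pos) (by positivity) (hstep N)
      nlinarith [mul_le_mul_of_nonneg_left h2 ha]
  have hMq := hpos M hM
  have hlowM : 4 * a * √(√M) = 4 * a * M / √(√M) ^ 3 := by
    rw [eq_div_iff (by positivity)]
    nth_rewrite 3 [← sqrt_sqrt_pow_four (Nat.cast_nonneg M)]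
    ring
  have hhigh : ∀ N : ℕ, M ≤ N → ∑ h ∈ Finset.range (N + 1), f h
      ≤ 4 * a * √(√M) + 4 / 3 * b * (1 / √(√M) ^ 3 - 1 / √(√N) ^ 3) := by
    intro N hN
    induction N, hN using Nat.le_induction with
    | base => simpa using hlow M
    | succ N hN ih =>
      rw [Finset.sum_range_succ]
      have h1 := hfb (N + 1) N.succ_pos
      have h2 := one_div_pow_seven_le_of_pow_four_eq (hpos (N + 1) N.succ_pos)
        (hpos N (by omega)) (hstep N)
      nlinarith [mul_le_mul_of_nonneg_left h2 hb]
  rw [add_div, ← hlowM]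
  have hb' : 0 ≤ 4 / 3 * b / √(√M) ^ 3 := by positivity
  rcases N with _ | N
  · simp only [Finset.range_zero, Finset.sum_empty]
    positivity
  rcases le_total M N with h | h
  · refine (hhigh N h).trans ?_
    have : 0 ≤ 4 / 3 * b * (1 / √(√N) ^ 3) := by positivity
    rw [mul_sub, mul_one_div]
    linarith
  · refine (hlow N).trans ?_
    have : √(√(N : ℝ)) ≤ √(√M) := by gcongr
    nlinarith [mul_le_mul_of_nonneg_left this ha]

theorem hasSum_cos_div_sq_bernoulliFun_two_fract (x : ℝ) :
    HasSum (fun h : ℕ => 1 / (h : ℝ) ^ 2 * Real.cos (2 * π * h * x))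
      (π ^ 2 * bernoulliFun 2 (Int.fract x)) := by
  have h := hasSum_one_div_nat_pow_mul_cos one_ne_zero
    (x := Int.fract x) ⟨Int.fract_nonneg x, (Int.fract_lt_one x).le⟩
  convert h using 1
  · funext k
    rw [Int.fract, mul_sub, show 2 * π * (k : ℝ) * (⌊x⌋ : ℝ) = ((k * ⌊x⌋ : ℤ) : ℝ) * (2 * π) by
      push_cast; ring, Real.cos_sub_int_mul_two_pi, mul_one]
  · rw [← bernoulliFun]
    simp only [mul_one, Nat.factorial]
    push_cast
    ring

theorem abs_sum_cos_add_sub_cos_le (y : ℕ → ℝ) (n : ℕ) (h δ : ℝ) :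
    |∑ k ∈ Finset.range n, (Real.cos (2 * π * h * (y k + δ)) - Real.cos (2 * π * h * y k))|
      ≤ min 2 (2 * π * |h * δ|) * ‖∑ k ∈ Finset.range n, (Real.fourierChar (h * y k) : ℂ)‖ := by
  have hre : ∀ x : ℝ, Real.cos (2 * π * h * x) = ((Real.fourierChar (h * x) : ℂ)).re := by
    intro x
    rw [Real.fourierChar_apply, Complex.exp_ofReal_mul_I_re]
    congr 1; ring
  have hfac : ∑ k ∈ Finset.range n,
        (Real.cos (2 * π * h * (y k + δ)) - Real.cos (2 * π * h * y k))
      = (((Real.fourierChar (h * δ) : ℂ) - 1)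
        * ∑ k ∈ Finset.range n, (Real.fourierChar (h * y k) : ℂ)).re := by
    rw [Finset.mul_sum, Complex.re_sum]
    refine Finset.sum_congr rfl fun k _ => ?_
    rw [hre, hre, ← Complex.sub_re, mul_add, AddChar.map_add_eq_mul, Circle.coe_mul]
    congr 1; ring
  rw [hfac]
  refine (Complex.abs_re_le_norm _).trans ?_
  rw [norm_mul]
  gcongr
  refine le_min ?_ ?_
  · refine (norm_sub_le _ _).trans ?_
    rw [Circle.norm_coe, norm_one]; norm_num
  · rw [Real.fourierChar_apply, mul_comm _ Complex.I]
    refine Real.norm_exp_I_mul_ofReal_sub_one_le.trans ?_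
    rw [norm_mul, Real.norm_eq_abs, Real.norm_eq_abs, abs_of_pos (by positivity : 0 < 2 * π)]

theorem abs_sum_bernoulliFun_two_fract_sub_le {α : ℝ}
    (hα : ∀ p q : ℤ, q ≠ 0 → 1 / (3 * |(q : ℝ)|) ≤ |q * α - p|) (A B : ℝ) {n M : ℕ}
    (hn : 0 < n) (hM : 0 < M) :
    |∑ k ∈ Finset.range n, (bernoulliFun 2 (Int.fract (α * k ^ 2 + A * k + B + 1 / M))
      - bernoulliFun 2 (Int.fract (α * k ^ 2 + A * k + B)))| ≤ 22 * n / (√(√n) * √(√M) ^ 3) := by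
  set y : ℕ → ℝ := fun k => α * k ^ 2 + A * k + B with hy
  set F : ℕ → ℝ := fun h => 1 / (h : ℝ) ^ 2 * ∑ k ∈ Finset.range n,
    (Real.cos (2 * π * h * (y k + 1 / M)) - Real.cos (2 * π * h * y k)) with hF
  have hsum : HasSum F (π ^ 2 * ∑ k ∈ Finset.range n, (bernoulliFun 2 (Int.fract (y k + 1 / M))
      - bernoulliFun 2 (Int.fract (y k)))) := by
    simp only [hF, Finset.mul_sum, mul_sub]
    exact hasSum_sum fun k _ => (hasSum_cos_div_sq_bernoulliFun_two_fract _).sub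
      (hasSum_cos_div_sq_bernoulliFun_two_fract _)
  have hpos : ∀ h : ℕ, 0 < h → 0 < √(√(h : ℝ)) := fun h hh =>
    Real.sqrt_pos.2 (Real.sqrt_pos.2 (by exact_mod_cast hh))
  have hnq := hpos n hn
  have hMq := hpos M hM
  have hM' : (0 : ℝ) < M := by exact_mod_cast hM
  have hFle : ∀ h : ℕ, 0 < h → |F h| ≤ 1 / √(√h) ^ 8 *
      (min 2 (2 * π * (√(√h) ^ 4 / M)) * (7 * n * (√(√h) / √(√n)))) := by
    intro h hh
    have hq := hpos h hh
    have h4 := sqrt_sqrt_pow_four (Nat.cast_nonneg (α := ℝ) h)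
    rw [hF, abs_mul, abs_of_nonneg (by positivity),
      show √(√(h : ℝ)) ^ 8 = (√(√(h : ℝ)) ^ 4) ^ 2 by ring, h4]
    refine mul_le_mul_of_nonneg_left ?_ (by positivity)
    refine (abs_sum_cos_add_sub_cos_le y n h (1 / M)).trans ?_
    rw [mul_one_div, abs_of_nonneg (by positivity : (0 : ℝ) ≤ h / M)]
    refine mul_le_mul_of_nonneg_left ?_ (le_min (by norm_num) (by positivity))
    refine norm_sum_fourierChar_quadratic_le hα A B hn hh (by positivity) ?_
    rw [div_pow, h4, sqrt_sqrt_pow_four (Nat.cast_nonneg n)]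
    field_simp
  have hpart : ∀ N : ℕ, ∑ h ∈ Finset.range N, |F h|
      ≤ (4 * (14 * π * n / (M * √(√n))) * M + 4 / 3 * (14 * n / √(√n))) / √(√M) ^ 3 := by
    refine sum_range_le_of_le_fourth_root (by positivity) (by positivity) (by simp [hF]) ?_ ?_ hM
    · intro h hh
      have hq := hpos h hh
      refine (hFle h hh).trans ?_
      calc _ ≤ 1 / √(√h) ^ 8 * ((2 * π * (√(√h) ^ 4 / M)) * (7 * n * (√(√h) / √(√n)))) := by
            gcongr; exact min_le_right _ _
        _ = _ := by field_simp; ring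
    · intro h hh
      have hq := hpos h hh
      refine (hFle h hh).trans ?_
      calc _ ≤ 1 / √(√h) ^ 8 * (2 * (7 * n * (√(√h) / √(√n)))) := by
            gcongr; exact min_le_left _ _
        _ = _ := by field_simp; ring
  have hlim : |π ^ 2 * ∑ k ∈ Finset.range n, (bernoulliFun 2 (Int.fract (y k + 1 / M))
      - bernoulliFun 2 (Int.fract (y k)))|
      ≤ (4 * (14 * π * n / (M * √(√n))) * M + 4 / 3 * (14 * n / √(√n))) / √(√M) ^ 3 :=
    le_of_tendsto' hsum.tendsto_sum_nat.abs fun N =>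
      (Finset.abs_sum_le_sum_abs _ _).trans (hpart N)
  rw [abs_mul, abs_of_pos (by positivity)] at hlim
  have hconst : (4 * (14 * π * n / (M * √(√n))) * M + 4 / 3 * (14 * n / √(√n))) / √(√M) ^ 3
      = (56 * π + 56 / 3) * (n / (√(√n) * √(√M) ^ 3)) := by
    field_simp
    ring
  rw [hconst] at hlim
  have hpi : 56 * π + 56 / 3 ≤ π ^ 2 * 22 := by
    nlinarith [Real.pi_gt_d2, Real.pi_lt_d2]
  have hX : 0 ≤ n / (√(√n) * √(√M) ^ 3) := by positivity
  refine le_of_mul_le_mul_left (hlim.trans ?_) (by positivity : 0 < π ^ 2)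
  calc _ ≤ π ^ 2 * 22 * (n / (√(√n) * √(√M) ^ 3)) := by gcongr
    _ = _ := by ring

theorem fract_add_of_mem_Icc (y : ℝ) {δ : ℝ} (h0 : 0 ≤ δ) (h1 : δ ≤ 1) :
    (Int.fract (y + δ) = Int.fract y + δ ∧ Int.fract y + δ < 1) ∨
      (Int.fract (y + δ) = Int.fract y + δ - 1 ∧ 1 ≤ Int.fract y + δ) := by
  have hy0 := Int.fract_nonneg y
  have hy1 := Int.fract_lt_one y
  have hfl := Int.self_sub_floor y
  rcases lt_or_ge (Int.fract y + δ) 1 with h | h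
  · refine Or.inl ⟨Int.fract_eq_iff.2 ⟨by linarith, h, ⌊y⌋, by linarith⟩, h⟩
  · refine Or.inr ⟨Int.fract_eq_iff.2 ⟨by linarith, by linarith, ⌊y⌋ + 1, ?_⟩, h⟩
    push_cast
    linarith

theorem bernoulliFun_two_fract_add_sub_le (y : ℝ) {δ : ℝ} (h0 : 0 ≤ δ) (h1 : δ ≤ 1) :
    bernoulliFun 2 (Int.fract (y + δ)) - bernoulliFun 2 (Int.fract y)
      ≤ 2 * δ * (Int.fract y - 1 / 2) + δ ^ 2 := by
  rw [bernoulliFun_two, bernoulliFun_two]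
  rcases fract_add_of_mem_Icc y h0 h1 with ⟨h, _⟩ | ⟨h, _⟩ <;> rw [h] <;> nlinarith

theorem le_bernoulliFun_two_fract_add_sub (y : ℝ) {δ : ℝ} (h0 : 0 ≤ δ) (h1 : δ ≤ 1) :
    2 * δ * (Int.fract (y + δ) - 1 / 2) - δ ^ 2
      ≤ bernoulliFun 2 (Int.fract (y + δ)) - bernoulliFun 2 (Int.fract y) := by
  rw [bernoulliFun_two, bernoulliFun_two]
  have := Int.fract_lt_one y
  rcases fract_add_of_mem_Icc y h0 h1 with ⟨h, _⟩ | ⟨h, _⟩ <;> rw [h] <;> nlinarith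

theorem abs_sum_fract_sub_half_le {α : ℝ}
    (hα : ∀ p q : ℤ, q ≠ 0 → 1 / (3 * |(q : ℝ)|) ≤ |q * α - p|) (A B : ℝ) {n M : ℕ}
    (hn : 0 < n) (hM : 0 < M) :
    |∑ k ∈ Finset.range n, (Int.fract (α * k ^ 2 + A * k + B) - 1 / 2)|
      ≤ n * (1 / (2 * M) + 11 * (√(√M) / √(√n))) := by
  have hM' : (0 : ℝ) < M := by exact_mod_cast hM
  have hn' : (0 : ℝ) < n := by exact_mod_cast hn
  set δ : ℝ := 1 / M with hδ
  have hδ0 : 0 < δ := by positivity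
  have hδ1 : δ ≤ 1 := by
    rw [hδ, div_le_one hM']; exact_mod_cast hM
  have hq : 0 < √(√(M : ℝ)) := Real.sqrt_pos.2 (Real.sqrt_pos.2 hM')
  have hqn : 0 < √(√(n : ℝ)) := Real.sqrt_pos.2 (Real.sqrt_pos.2 hn')
  have hbound : n * (1 / (2 * M) + 11 * (√(√M) / √(√n)))
      = (n * δ ^ 2 + 22 * n / (√(√n) * √(√M) ^ 3)) / (2 * δ) := by
    rw [hδ]
    field_simp
    linear_combination (22 * (M : ℝ)) * sqrt_sqrt_pow_four hM'.le
  have hδ2 : 0 < 2 * δ := by positivity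
  rw [hbound, le_div_iff₀ hδ2, mul_comm _ (2 * δ)]
  nth_rewrite 1 [← abs_of_pos hδ2]
  rw [← abs_mul, abs_le']
  constructor
  · have h := abs_sum_bernoulliFun_two_fract_sub_le hα A (B - δ) hn hM
    have hle : ∑ k ∈ Finset.range n, (2 * δ * (Int.fract (α * k ^ 2 + A * k + B) - 1 / 2) - δ ^ 2)
        ≤ _ := (Finset.sum_le_sum fun k _ => ?_).trans ((le_abs_self _).trans h)
    · rw [Finset.sum_sub_distrib, ← Finset.mul_sum] at hle
      simp only [Finset.sum_const, Finset.card_range, nsmul_eq_mul] at hle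
      linarith
    · have := le_bernoulliFun_two_fract_add_sub (α * k ^ 2 + A * k + (B - δ)) hδ0.le hδ1
      rwa [show α * (k : ℝ) ^ 2 + A * k + (B - δ) + δ = α * k ^ 2 + A * k + B by ring] at this ⊢
  · have h := abs_sum_bernoulliFun_two_fract_sub_le hα A B hn hM
    have hle := (neg_le_of_abs_le h).trans (Finset.sum_le_sum fun k _ =>
      bernoulliFun_two_fract_add_sub_le (α * k ^ 2 + A * k + B) hδ0.le hδ1)
    rw [Finset.sum_add_distrib, ← Finset.mul_sum] at hle
    simp only [Finset.sum_const, Finset.card_range, nsmul_eq_mul] at hle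
    linarith

theorem fract_sub_of_mem_Icc (x : ℝ) {β : ℝ} (h0 : 0 ≤ β) (h1 : β ≤ 1) :
    Int.fract (x - β) = Int.fract x - β + if Int.fract x < β then 1 else 0 := by
  have hx0 := Int.fract_nonneg x
  have hx1 := Int.fract_lt_one x
  have hfl := Int.self_sub_floor x
  split_ifs with h
  · refine Int.fract_eq_iff.2 ⟨by linarith, by linarith, ⌊x⌋ - 1, ?_⟩
    push_cast
    linarith
  · exact Int.fract_eq_iff.2 ⟨by linarith, by linarith, ⌊x⌋, by linarith⟩

theorem ncard_fract_mem_Ico_sub (a : ℕ → ℝ) (n : ℕ) {α β : ℝ} (h0 : 0 ≤ α) (hαβ : α ≤ β)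
    (h1 : β ≤ 1) :
    ({k : ℕ | k < n ∧ Int.fract (a k) ∈ Set.Ico α β}.ncard : ℝ) - n * (β - α)
      = ∑ k ∈ Finset.range n, (Int.fract (a k - β) - 1 / 2)
        - ∑ k ∈ Finset.range n, (Int.fract (a k - α) - 1 / 2) := by
  classical
  have hset : {k : ℕ | k < n ∧ Int.fract (a k) ∈ Set.Ico α β}
      = ↑((Finset.range n).filter fun k => Int.fract (a k) ∈ Set.Ico α β) := by
    ext k; simp
  rw [hset, Set.ncard_coe_finset, Finset.card_filter, ← Finset.sum_sub_distrib]
  push_cast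
  rw [sub_eq_iff_eq_add, show (n : ℝ) * (β - α) = ∑ _k ∈ Finset.range n, (β - α) by
    rw [Finset.sum_const, Finset.card_range, nsmul_eq_mul],
    ← Finset.sum_add_distrib]
  refine Finset.sum_congr rfl fun k _ => ?_
  rw [fract_sub_of_mem_Icc _ (h0.trans hαβ) h1, fract_sub_of_mem_Icc _ h0 (hαβ.trans h1)]
  simp only [Set.mem_Ico]
  split_ifs <;> first | (exfalso; grind) | ring

theorem discrepancy_quadratic_le {α : ℝ}
    (hα : ∀ p q : ℤ, q ≠ 0 → 1 / (3 * |(q : ℝ)|) ≤ |q * α - p|) (A B : ℝ) {n M : ℕ}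
    (hn : 0 < n) (hM : 0 < M) :
    discrepancy n (fun k => α * (k : ℝ) ^ 2 + A * (k : ℝ) + B)
      ≤ 1 / M + 22 * (√(√M) / √(√n)) := by
  have hn' : (0 : ℝ) < n := by exact_mod_cast hn
  refine Real.sSup_le ?_ (by positivity)
  rintro t ⟨a, b, h0, hab, h1, rfl⟩
  have hcount := ncard_fract_mem_Ico_sub (fun k => α * (k : ℝ) ^ 2 + A * (k : ℝ) + B) n h0 hab h1
  have hb := abs_sum_fract_sub_half_le hα A (B - b) hn hM
  have ha := abs_sum_fract_sub_half_le hα A (B - a) hn hM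
  simp only [← add_sub_assoc] at ha hb
  set N := {k : ℕ | k < n ∧ Int.fract (α * (k : ℝ) ^ 2 + A * (k : ℝ) + B) ∈ Set.Ico a b}.ncard
  have hfrac : (N : ℝ) / n - (b - a) = (N - n * (b - a)) / n := by field_simp
  rw [hfrac, abs_div, abs_of_pos hn', div_le_iff₀ hn', hcount]
  refine (abs_sub _ _).trans ((add_le_add hb ha).trans (le_of_eq ?_))
  field_simp
  ring

theorem five_lt_log_of_ten_mul_log_div_lt_one {n : ℕ} (hn : 2 ≤ n)
    (hsmall : 10 * Real.log n / (n : ℝ) ^ ((1 : ℝ) / 5) < 1) : 5 < Real.log n := by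
  have hn' : (2 : ℝ) ≤ n := by exact_mod_cast hn
  have hx : 0 < (n : ℝ) ^ ((1 : ℝ) / 5) := by positivity
  rw [div_lt_one hx] at hsmall
  have hlog2 : Real.log 2 ≤ Real.log n := Real.log_le_log (by norm_num) hn'
  have hexp : Real.exp 1 < (n : ℝ) ^ ((1 : ℝ) / 5) := by
    linarith [Real.log_two_gt_d9, Real.exp_one_lt_d9]
  rw [← Real.lt_log_iff_exp_lt hx, Real.log_rpow (by linarith)] at hexp
  linarith


/-- Let `z = (-1+√5)/2` and `r > 0` with `r² - z ∈ ℤ`. Then for every `n ≥ 2` with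
`10 (log n)/n^(1/5) < 1`, the quadratic sequence `a_k = r²k² + Ak + B` has discrepancy
`D_n(a) < 10 (log n)/n^(1/5)`. -/
theorem discrepancy_of_quadratic_sequence (r : ℝ) (hr : 0 < r)
    (hrz : ∃ m : ℤ, r ^ 2 - (-1 + Real.sqrt 5) / 2 = (m : ℝ))
    (A B : ℝ) (n : ℕ) (hn : 2 ≤ n)
    (hsmall : 10 * Real.log n / (n : ℝ) ^ ((1 : ℝ) / 5) < 1) :
    discrepancy n (fun k => r ^ 2 * (k : ℝ) ^ 2 + A * (k : ℝ) + B) <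
      10 * Real.log n / (n : ℝ) ^ ((1 : ℝ) / 5) := by
  obtain ⟨m, hm⟩ := hrz
  have hα : ∀ p q : ℤ, q ≠ 0 → 1 / (3 * |(q : ℝ)|) ≤ |q * r ^ 2 - p| := by
    intro p q hq
    convert one_div_three_mul_le_abs_mul_golden_sub (p - q * m) q hq using 2
    push_cast
    linear_combination (q : ℝ) * hm
  have hlog := five_lt_log_of_ten_mul_log_div_lt_one hn hsmall
  have hn' : (2 : ℝ) ≤ n := by exact_mod_cast hn
  set x := (n : ℝ) ^ ((1 : ℝ) / 5) with hx
  have hx1 : 1 ≤ x := Real.one_le_rpow (by linarith) (by norm_num)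
  have hx5 : x ^ 5 = n := by
    rw [hx, ← Real.rpow_natCast, ← Real.rpow_mul (by linarith)]
    norm_num
  have hM : 0 < ⌊x⌋₊ := Nat.floor_pos.2 hx1
  have hM' : (1 : ℝ) ≤ ⌊x⌋₊ := by exact_mod_cast hM
  have hMx : (⌊x⌋₊ : ℝ) ≤ x := Nat.floor_le (by linarith)
  have hxM : x ≤ 2 * ⌊x⌋₊ := by linarith [Nat.lt_floor_add_one x]
  refine (discrepancy_quadratic_le hα A B (by omega) hM).trans_lt ?_
  have hroot : √(√(n : ℝ)) = √(√x) * x := by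
    rw [← hx5, show x ^ 5 = x * (x ^ 2) ^ 2 by ring, Real.sqrt_mul (by linarith),
      Real.sqrt_sq (by positivity), Real.sqrt_mul (Real.sqrt_nonneg x), Real.sqrt_sq (by linarith)]
  have hx0 : 0 < √(√x) := Real.sqrt_pos.2 (Real.sqrt_pos.2 (by linarith))
  have h1 : 1 / (⌊x⌋₊ : ℝ) ≤ 2 / x := by
    rw [div_le_div_iff₀ (by linarith) (by linarith)]; linarith
  have h2 : √(√(⌊x⌋₊ : ℝ)) / √(√(n : ℝ)) ≤ 1 / x := by
    rw [hroot, ← div_div]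
    gcongr
    rw [div_le_one hx0]
    gcongr
  calc _ ≤ 2 / x + 22 * (1 / x) := by gcongr
    _ = 24 / x := by ring
    _ < _ := by gcongr; linarith
end
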